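/- Let U(t) = γ_e + e^t Γ(0,t) + log(t) for t > 0, where Γ(0,t) = ∫_t^∞ e^{-z} z^{-1} dz and γ_e is Euler's constant. Then ∫₀^∞ e^{-λt} U(t) dt = log(λ)/(λ² − λ) = 1/(λ · (λ−1)/log λ), i.e., U is the renewal function of the inverse of the uniform-mixture subordinator with φ(λ) = (λ−1)/log λ. Moreover U'(t) = e^t Γ(0,t), and 0 < e^t Γ(0,t) ≤ 1 for t ≥ 1, so U(t) ~ log(t) as t → ∞. -/

import Mathlib

open MeasureTheory Set Filter

theorem integral_log_mul_exp_neg_Ioi :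
    ∫ t in Ioi (0 : ℝ), Real.log t * Real.exp (-t) = -Real.eulerMascheroniConstant := by
  have h1 := Complex.hasDerivAt_GammaIntegral (s := 1) (by simp)
  have h2 := Complex.hasDerivAt_Gamma_one
  have h3 : Complex.Gamma =ᶠ[nhds 1] Complex.GammaIntegral := by
    have : IsOpen {s : ℂ | 0 < s.re} := isOpen_Ioi.preimage Complex.continuous_re
    filter_upwards [this.mem_nhds (x := 1) (by simp)] with a ha
      using Complex.Gamma_eq_integral ha
  have h4 := (h1.congr_of_eventuallyEq h3).unique h2
  simp only [sub_self, Complex.cpow_zero, one_mul] at h4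
  have h5 : ((∫ t in Ioi (0 : ℝ), Real.log t * Real.exp (-t) : ℝ) : ℂ)
      = ((-Real.eulerMascheroniConstant : ℝ) : ℂ) := by
    rw [← integral_complex_ofReal]
    push_cast at h4 ⊢
    exact h4
  exact_mod_cast h5

theorem integrableOn_log_mul_exp_neg_Ioi :
    IntegrableOn (fun t : ℝ => Real.log t * Real.exp (-t)) (Ioi 0) := by
  by_contra h
  have h1 := integral_log_mul_exp_neg_Ioi
  rw [integral_undef h] at h1
  linarith [Real.one_half_lt_eulerMascheroniConstant]

theorem integrableOn_exp_neg_mul_Ioi {l : ℝ} (hl : 0 < l) :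
    IntegrableOn (fun t : ℝ => Real.exp (-(l * t))) (Ioi 0) := by
  simpa only [neg_mul] using integrableOn_exp_mul_Ioi (neg_neg_of_pos hl) 0

theorem integral_exp_neg_mul_Ioi {l : ℝ} (hl : 0 < l) :
    ∫ t in Ioi (0 : ℝ), Real.exp (-(l * t)) = 1 / l := by
  simpa [neg_mul] using integral_exp_mul_Ioi (neg_neg_of_pos hl) 0

theorem log_mul_exp_neg_mul_eq {l t : ℝ} (hl : 0 < l) (ht : 0 < t) :
    Real.log (l * t) * Real.exp (-(l * t)) - Real.log l * Real.exp (-(l * t)) =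
      Real.exp (-(l * t)) * Real.log t := by
  rw [Real.log_mul hl.ne' ht.ne']
  ring

theorem integrableOn_comp_mul_log_mul_exp_neg {l : ℝ} (hl : 0 < l) :
    IntegrableOn (fun t : ℝ => Real.log (l * t) * Real.exp (-(l * t))) (Ioi 0) := by
  refine (integrableOn_Ioi_comp_mul_left_iff (fun t => Real.log t * Real.exp (-t)) 0 hl).2 ?_
  simpa using integrableOn_log_mul_exp_neg_Ioi

theorem integrableOn_exp_neg_mul_mul_log {l : ℝ} (hl : 0 < l) :
    IntegrableOn (fun t : ℝ => Real.exp (-(l * t)) * Real.log t) (Ioi 0) :=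
  ((integrableOn_comp_mul_log_mul_exp_neg hl).sub
    ((integrableOn_exp_neg_mul_Ioi hl).const_mul (Real.log l))).congr_fun
    (fun _ ht => log_mul_exp_neg_mul_eq hl ht) measurableSet_Ioi

/-- The Laplace transform of the logarithm. -/
theorem integral_exp_neg_mul_mul_log {l : ℝ} (hl : 0 < l) :
    ∫ t in Ioi (0 : ℝ), Real.exp (-(l * t)) * Real.log t =
      -(Real.eulerMascheroniConstant + Real.log l) / l := by
  rw [← setIntegral_congr_fun measurableSet_Ioi fun t ht => log_mul_exp_neg_mul_eq hl ht,
    integral_sub (integrableOn_comp_mul_log_mul_exp_neg hl)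
      ((integrableOn_exp_neg_mul_Ioi hl).const_mul _),
    integral_const_mul, integral_exp_neg_mul_Ioi hl,
    integral_comp_mul_left_Ioi (fun t => Real.log t * Real.exp (-t)) 0 hl, mul_zero,
    integral_log_mul_exp_neg_Ioi, smul_eq_mul]
  field_simp
  ring

theorem integrableOn_exp_neg_div {t : ℝ} (ht : 0 < t) :
    IntegrableOn (fun z : ℝ => Real.exp (-z) / z) (Ioi t) := by
  refine ((integrableOn_exp_neg_Ioi t).div_const t).mono'
    (Measurable.aestronglyMeasurable (by fun_prop)) ?_
  filter_upwards [ae_restrict_mem measurableSet_Ioi] with z hz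
  have hz' : t < z := hz
  rw [Real.norm_of_nonneg (div_nonneg (Real.exp_pos _).le (ht.trans hz').le)]
  gcongr

theorem integral_exp_neg_div_pos {t : ℝ} (ht : 0 < t) :
    0 < ∫ z in Ioi t, Real.exp (-z) / z := by
  rw [setIntegral_pos_iff_support_of_nonneg_ae _ (integrableOn_exp_neg_div ht)]
  · have : Ioi t ⊆ Function.support (fun z : ℝ => Real.exp (-z) / z) := fun z hz =>
      (div_pos (Real.exp_pos _) (ht.trans hz)).ne'
    rw [inter_eq_right.2 this]
    simp
  · filter_upwards [ae_restrict_mem measurableSet_Ioi] with z hz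
    exact (div_pos (Real.exp_pos _) (ht.trans hz)).le

theorem exp_mul_integral_exp_neg_div_le_inv {t : ℝ} (ht : 0 < t) :
    Real.exp t * ∫ z in Ioi t, Real.exp (-z) / z ≤ 1 / t := by
  have h : ∫ z in Ioi t, Real.exp (-z) / z ≤ Real.exp (-t) / t := by
    rw [← integral_exp_neg_Ioi t, ← integral_div]
    refine setIntegral_mono_on (integrableOn_exp_neg_div ht)
      ((integrableOn_exp_neg_Ioi t).div_const t) measurableSet_Ioi fun z hz => ?_
    have hz' : t < z := hz
    gcongr
  calc _ ≤ Real.exp t * (Real.exp (-t) / t) := by gcongr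
    _ = 1 / t := by rw [← mul_div_assoc, ← Real.exp_add, add_neg_cancel, Real.exp_zero]

theorem hasDerivAt_integral_exp_neg_div {t : ℝ} (ht : 0 < t) :
    HasDerivAt (fun s => ∫ z in Ioi s, Real.exp (-z) / z) (-(Real.exp (-t) / t)) t := by
  have ht2 : 0 < t / 2 := by positivity
  have hint := integrableOn_exp_neg_div ht2
  have h1 : HasDerivAt (fun s => ∫ z in (t / 2)..s, Real.exp (-z) / z) (Real.exp (-t) / t) t := by
    refine intervalIntegral.integral_hasDerivAt_right ?_ ?_ ?_
    · rw [intervalIntegrable_iff_integrableOn_Ioc_of_le (by linarith)]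
      exact hint.mono_set Ioc_subset_Ioi_self
    · exact (Measurable.stronglyMeasurable (by fun_prop)).stronglyMeasurableAtFilter
    · exact ContinuousAt.div (by fun_prop) continuousAt_id ht.ne'
  refine (h1.const_sub (∫ z in Ioi (t / 2), Real.exp (-z) / z)).congr_of_eventuallyEq ?_
  filter_upwards [Ioi_mem_nhds (half_lt_self ht)] with s hs
  rw [← intervalIntegral.integral_Ioi_sub_Ioi hint (le_of_lt hs)]
  ring

theorem exp_mul_integral_exp_neg_div_eq {t : ℝ} (ht : 0 < t) :
    Real.exp t * ∫ z in Ioi t, Real.exp (-z) / z =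
      ∫ u in Ioi (0 : ℝ), Real.exp (-(t * u)) / (1 + u) := by
  have h1 : ∫ z in Ioi t, Real.exp (-z) / z =
      ∫ z in Ioi (0 : ℝ), Real.exp (-(z + t)) / (z + t) := by
    have h := (measurePreserving_add_right (volume : Measure ℝ) t).setIntegral_preimage_emb
      (measurableEmbedding_addRight t) (fun z => Real.exp (-z) / z) (Ioi t)
    rw [← h]
    simp
  have h2 := integral_comp_mul_left_Ioi (fun z => Real.exp (-(z + t)) / (z + t)) 0 ht
  rw [mul_zero, smul_eq_mul, ← h1] at h2
  have h3 : ∫ z in Ioi t, Real.exp (-z) / z =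
      t * ∫ x in Ioi (0 : ℝ), Real.exp (-(t * x + t)) / (t * x + t) := by
    rw [h2]; field_simp
  rw [h3, ← mul_assoc, ← integral_const_mul]
  refine setIntegral_congr_fun measurableSet_Ioi fun u hu => ?_
  have hu' : 0 < u := hu
  have e : Real.exp (-(t * u)) = Real.exp t * Real.exp (-(t * u + t)) := by
    rw [← Real.exp_add]; congr 1; ring
  have : 0 < t * u + t := by positivity
  simp only [e]
  field_simp
  ring

theorem hasDerivAt_log_one_add_sub_log_add {l u : ℝ} (hl : 0 < l) (hl1 : l ≠ 1) (hu : 0 ≤ u) :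
    HasDerivAt (fun u : ℝ => (Real.log (1 + u) - Real.log (l + u)) / (l - 1))
      (1 / ((1 + u) * (l + u))) u := by
  have h1 : HasDerivAt (fun u : ℝ => Real.log (1 + u)) (1 / (1 + u)) u :=
    ((hasDerivAt_id u).const_add 1).log (by simp; positivity)
  have h2 : HasDerivAt (fun u : ℝ => Real.log (l + u)) (1 / (l + u)) u :=
    ((hasDerivAt_id u).const_add l).log (by simp; positivity)
  have h3 : l - 1 ≠ 0 := sub_ne_zero.2 hl1
  have h4 : 1 + u ≠ 0 := by positivity
  have h5 : l + u ≠ 0 := by positivity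
  refine ((h1.sub h2).div_const (l - 1)).congr_deriv ?_
  field_simp
  ring

theorem tendsto_log_one_add_sub_log_add (l : ℝ) :
    Tendsto (fun u : ℝ => (Real.log (1 + u) - Real.log (l + u)) / (l - 1)) atTop (nhds 0) := by
  have h1 : Tendsto (fun u : ℝ => (1 + u) / (l + u)) atTop (nhds 1) := by
    have h2 : Tendsto (fun u : ℝ => (1 - l) / (l + u)) atTop (nhds 0) :=
      (tendsto_atTop_add_const_left _ l tendsto_id).const_div_atTop _
    have h3 := h2.const_add 1
    rw [add_zero] at h3
    refine h3.congr' ?_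
    filter_upwards [eventually_gt_atTop (-l)] with u hu
    have : l + u ≠ 0 := by linarith
    field_simp
    ring
  have h4 := ((Real.continuousAt_log one_ne_zero).tendsto.comp h1).div_const (l - 1)
  rw [Real.log_one, zero_div] at h4
  refine h4.congr' ?_
  filter_upwards [eventually_gt_atTop (-l), eventually_gt_atTop (-1)] with u hu hu1
  rw [Function.comp_apply, Real.log_div (by linarith) (by linarith)]

theorem integrableOn_inv_one_add_mul_add {l : ℝ} (hl : 0 < l) (hl1 : l ≠ 1) :
    IntegrableOn (fun u : ℝ => 1 / ((1 + u) * (l + u))) (Ioi 0) :=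
  integrableOn_Ioi_deriv_of_nonneg'
    (fun _ hu => hasDerivAt_log_one_add_sub_log_add hl hl1 hu)
    (fun u hu => by have : 0 < u := hu; positivity) (tendsto_log_one_add_sub_log_add l)

theorem integral_inv_one_add_mul_add {l : ℝ} (hl : 0 < l) (hl1 : l ≠ 1) :
    ∫ u in Ioi (0 : ℝ), 1 / ((1 + u) * (l + u)) = Real.log l / (l - 1) := by
  rw [integral_Ioi_of_hasDerivAt_of_nonneg'
    (fun _ hu => hasDerivAt_log_one_add_sub_log_add hl hl1 hu)
    (fun u hu => by have : 0 < u := hu; positivity) (tendsto_log_one_add_sub_log_add l)]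
  simp [neg_div]

theorem integral_exp_neg_add_mul_div {l u : ℝ} (hl : 0 < l) (hu : 0 < u) :
    ∫ t in Ioi (0 : ℝ), Real.exp (-((l + u) * t)) / (1 + u) = 1 / ((1 + u) * (l + u)) := by
  rw [integral_div, integral_exp_neg_mul_Ioi (by positivity)]
  field_simp

theorem integrable_exp_neg_add_mul_div_prod {l : ℝ} (hl : 0 < l) (hl1 : l ≠ 1) :
    Integrable (fun p : ℝ × ℝ => Real.exp (-((l + p.2) * p.1)) / (1 + p.2))
      ((volume.restrict (Ioi 0)).prod (volume.restrict (Ioi 0))) := by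
  rw [integrable_prod_iff' (Measurable.aestronglyMeasurable (by fun_prop))]
  constructor
  · filter_upwards [ae_restrict_mem measurableSet_Ioi] with u hu
    have hu' : 0 < u := hu
    exact (integrableOn_exp_neg_mul_Ioi (by positivity)).div_const _
  · refine (integrableOn_inv_one_add_mul_add hl hl1).congr_fun (fun u hu => ?_) measurableSet_Ioi
    have hu' : 0 < u := hu
    simp only
    rw [← integral_exp_neg_add_mul_div hl hu']
    congr 1 with t
    rw [Real.norm_of_nonneg (by positivity)]

theorem integral_exp_neg_add_mul_div_right {l t : ℝ} (ht : 0 < t) :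
    ∫ u in Ioi (0 : ℝ), Real.exp (-((l + u) * t)) / (1 + u) =
      Real.exp (-(l * t)) * (Real.exp t * ∫ z in Ioi t, Real.exp (-z) / z) := by
  rw [exp_mul_integral_exp_neg_div_eq ht, ← integral_const_mul]
  congr 1 with u
  rw [← mul_div_assoc, ← Real.exp_add]
  ring_nf

theorem integrableOn_exp_neg_mul_mul_exp_mul_integral {l : ℝ} (hl : 0 < l) (hl1 : l ≠ 1) :
    IntegrableOn (fun t : ℝ =>
      Real.exp (-(l * t)) * (Real.exp t * ∫ z in Ioi t, Real.exp (-z) / z)) (Ioi 0) :=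
  IntegrableOn.congr_fun (integrable_exp_neg_add_mul_div_prod hl hl1).integral_prod_left
    (fun _ ht => integral_exp_neg_add_mul_div_right ht) measurableSet_Ioi

/-- The Laplace transform of `t ↦ e^t Γ(0,t)`. -/
theorem integral_exp_neg_mul_mul_exp_mul_integral {l : ℝ} (hl : 0 < l) (hl1 : l ≠ 1) :
    ∫ t in Ioi (0 : ℝ), Real.exp (-(l * t)) * (Real.exp t * ∫ z in Ioi t, Real.exp (-z) / z) =
      Real.log l / (l - 1) := by
  rw [← setIntegral_congr_fun measurableSet_Ioi fun t ht =>
      integral_exp_neg_add_mul_div_right (l := l) ht,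
    integral_integral_swap (integrable_exp_neg_add_mul_div_prod hl hl1),
    setIntegral_congr_fun measurableSet_Ioi fun u hu => integral_exp_neg_add_mul_div hl hu,
    integral_inv_one_add_mul_add hl hl1]

/-- The renewal function of the inverse of the uniform-mixture subordinator with
`φ(λ) = (λ-1)/log λ` is `U(t) = γ_e + e^t Γ(0,t) + log t`; moreover `U'(t) = e^t Γ(0,t)`,
`0 < e^t Γ(0,t) ≤ 1` for `t ≥ 1`, and `U(t) ~ log t` as `t → ∞`. -/
theorem uniform_mixture_renewal_function
    (G : ℝ → ℝ) (hG : ∀ t > (0:ℝ), G t = ∫ z in Ioi t, Real.exp (-z) / z)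
    (U : ℝ → ℝ)
    (hU : ∀ t > (0:ℝ),
      U t = Real.eulerMascheroniConstant + Real.exp t * G t + Real.log t) :
    (∀ l > (0:ℝ), l ≠ 1 →
        ∫ t in Ioi (0:ℝ), Real.exp (-(l * t)) * U t = Real.log l / (l ^ 2 - l)) ∧
      (∀ t > (0:ℝ), deriv U t = Real.exp t * G t) ∧
      (∀ t ≥ (1:ℝ), 0 < Real.exp t * G t ∧ Real.exp t * G t ≤ 1) ∧
      Tendsto (fun t => U t / Real.log t) atTop (nhds 1) := by
  have hbound : ∀ t ≥ (1:ℝ), 0 < Real.exp t * G t ∧ Real.exp t * G t ≤ 1 := by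
    intro t ht
    have ht0 : 0 < t := by linarith
    rw [hG t ht0]
    exact ⟨mul_pos (Real.exp_pos _) (integral_exp_neg_div_pos ht0),
      (exp_mul_integral_exp_neg_div_le_inv ht0).trans ((div_le_one ht0).2 ht)⟩
  refine ⟨fun l hl hl1 => ?_, fun t ht => ?_, hbound, ?_⟩
  · have hcongr : ∀ t ∈ Ioi (0:ℝ), Real.exp (-(l * t)) * U t =
        Real.exp (-(l * t)) * Real.eulerMascheroniConstant +
          Real.exp (-(l * t)) * (Real.exp t * ∫ z in Ioi t, Real.exp (-z) / z) +
          Real.exp (-(l * t)) * Real.log t := by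
      intro t ht
      rw [hU t ht, hG t ht]
      ring
    have hconst := (integrableOn_exp_neg_mul_Ioi hl).mul_const Real.eulerMascheroniConstant
    have hexp := integrableOn_exp_neg_mul_mul_exp_mul_integral hl hl1
    have hsum : IntegrableOn (fun t => Real.exp (-(l * t)) * Real.eulerMascheroniConstant +
        Real.exp (-(l * t)) * (Real.exp t * ∫ z in Ioi t, Real.exp (-z) / z)) (Ioi 0) :=
      hconst.add hexp
    rw [setIntegral_congr_fun measurableSet_Ioi hcongr,
      integral_add hsum (integrableOn_exp_neg_mul_mul_log hl),
      integral_add hconst hexp, integral_mul_const, integral_exp_neg_mul_Ioi hl,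
      integral_exp_neg_mul_mul_exp_mul_integral hl hl1, integral_exp_neg_mul_mul_log hl]
    have h1 : l - 1 ≠ 0 := sub_ne_zero.2 hl1
    rw [show l ^ 2 - l = l * (l - 1) by ring]
    field_simp
    ring
  · have h := (((Real.hasDerivAt_exp t).mul (hasDerivAt_integral_exp_neg_div ht)).const_add
      Real.eulerMascheroniConstant).add (Real.hasDerivAt_log ht.ne')
    have hloc : U =ᶠ[nhds t] fun s => Real.eulerMascheroniConstant +
        Real.exp s * (∫ z in Ioi s, Real.exp (-z) / z) + Real.log s := by
      filter_upwards [Ioi_mem_nhds ht] with s hs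
      rw [hU s hs, hG s hs]
    rw [(h.congr_of_eventuallyEq hloc).deriv, hG t ht, Real.exp_neg]
    field_simp
    ring
  · have hlim (c : ℝ) : Tendsto (fun t : ℝ => c / Real.log t + 1) atTop (nhds 1) := by
      simpa using (Real.tendsto_log_atTop.const_div_atTop c).add_const 1
    refine tendsto_of_tendsto_of_tendsto_of_le_of_le' (hlim Real.eulerMascheroniConstant)
      (hlim (Real.eulerMascheroniConstant + 1)) ?_ ?_ <;>
    · filter_upwards [eventually_gt_atTop (1:ℝ)] with t ht
      have hlog := Real.log_pos ht
      have hb := hbound t ht.le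
      rw [hU t (by linarith), div_add_one hlog.ne']
      gcongr
      linarith
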